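/- arXiv:1510.00892 — 2 statements merged into one kernel-verified Lean document; each statement's English description precedes it below -/
import Mathlib

section
/- Every algebra A in I₂,₀ satisfies the identity x → (y → x') = y → x'. -/
/-- The laws of the variety I₂,₀: the implication zroupoid identity and involutivity of
`x ↦ i x z`. The law for `z` itself is an instance of involutivity. -/
structure IsInvolutiveZroupoid {A : Type*} (i : A → A → A) (z : A) : Prop where
  imp_imp : ∀ x y w : A, i (i x y) w = i (i (i (i w z) x) (i (i y w) z)) z
  neg_neg : ∀ x : A, i (i x z) z = x

namespace IsInvolutiveZroupoid

variable {A : Type*} {i : A → A → A} {z : A}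

theorem neg_imp_neg (h : IsInvolutiveZroupoid i z) (x y w : A) :
    i (i (i (i x z) y) (i (i w x) z)) z = i (i y w) x := by
  rw [h.imp_imp y w x]

theorem neg_imp_neg_self (h : IsInvolutiveZroupoid i z) (x y : A) :
    i (i x (i (i y x) z)) z = i (i z y) x := by
  calc i (i x (i (i y x) z)) z
    _ = i (i (i (i x z) z) (i (i y x) z)) z := by rw [h.neg_neg x]
    _ = i (i z y) x := by rw [h.neg_imp_neg x z y]

theorem neg_one_imp_imp (h : IsInvolutiveZroupoid i z) (x y : A) :
    i (i (i (i z z) x) y) z = i (i x y) z := by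
  calc i (i (i (i z z) x) y) z
    _ = i (i (i (i z z) x) (i (i y z) z)) z := by rw [h.neg_neg y]
    _ = i (i x y) z := by rw [h.neg_imp_neg z x y]

theorem one_imp (h : IsInvolutiveZroupoid i z) (x : A) :
    i (i z z) x = x := by
  calc i (i z z) x
    _ = i (i (i (i z z) x) z) z := by rw [h.neg_neg (i (i z z) x)]
    _ = x := by rw [h.neg_one_imp_imp x z, h.neg_neg x]

theorem zero_imp_imp_one_self (h : IsInvolutiveZroupoid i z) (x : A) :
    i (i z x) (i z z) = i x (i z z) := by
  calc i (i z x) (i z z)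
    _ = i (i (i z z) (i (i x (i z z)) z)) z := by rw [h.neg_imp_neg_self (i z z) x]
    _ = i x (i z z) := by rw [h.one_imp (i (i x (i z z)) z), h.neg_neg (i x (i z z))]

theorem zero_imp_one (h : IsInvolutiveZroupoid i z) :
    i z (i z z) = i z z := by
  calc i z (i z z)
    _ = i (i z z) (i z z) := by rw [h.zero_imp_imp_one_self z]
    _ = i z z := by rw [h.one_imp (i z z)]

theorem neg_imp_one (h : IsInvolutiveZroupoid i z) (x : A) :
    i (i x z) (i z z) = i z x := by
  calc i (i x z) (i z z)
    _ = i (i (i (i (i z z) z) x) (i (i z (i z z)) z)) z := by rw [h.neg_imp_neg (i z z) x z]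
    _ = i z x := by rw [h.zero_imp_one, h.neg_neg z, h.neg_neg (i z x)]

theorem imp_one (h : IsInvolutiveZroupoid i z) (x : A) :
    i x (i z z) = i z (i x z) := by
  calc i x (i z z)
    _ = i (i (i x z) z) (i z z) := by rw [h.neg_neg x]
    _ = i z (i x z) := by rw [h.neg_imp_one (i x z)]

theorem zero_imp_neg_zero_imp (h : IsInvolutiveZroupoid i z) (x : A) :
    i z (i (i z x) z) = i x (i z z) := by
  calc i z (i (i z x) z)
    _ = i (i z x) (i z z) := by rw [h.imp_one (i z x)]
    _ = i x (i z z) := by rw [h.zero_imp_imp_one_self x]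

theorem zero_imp_neg_imp_one (h : IsInvolutiveZroupoid i z) (x : A) :
    i z (i (i x (i z z)) z) = i z x := by
  rw [h.imp_one x, h.zero_imp_neg_zero_imp (i x z), h.imp_one (i x z), h.neg_neg x]

theorem zero_imp_imp_one (h : IsInvolutiveZroupoid i z) (x : A) :
    i z (i x (i z z)) = i x (i z z) := by
  calc i z (i x (i z z))
    _ = i z (i (i z (i (i x (i z z)) z)) z) := by
      rw [h.zero_imp_neg_zero_imp (i (i x (i z z)) z), h.imp_one (i (i x (i z z)) z),
        h.neg_neg (i x (i z z))]
    _ = i x (i z z) := by rw [h.zero_imp_neg_imp_one x, h.zero_imp_neg_zero_imp x]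

theorem zero_imp_zero_imp_neg (h : IsInvolutiveZroupoid i z) (x : A) :
    i z (i z (i x z)) = i x (i z z) := by
  calc i z (i z (i x z))
    _ = i z (i x (i z z)) := by rw [h.imp_one x]
    _ = i x (i z z) := by rw [h.zero_imp_imp_one x]

theorem zero_imp_zero_imp (h : IsInvolutiveZroupoid i z) (x : A) :
    i z (i z x) = i z x := by
  calc i z (i z x)
    _ = i z (i z (i (i x z) z)) := by rw [h.neg_neg x]
    _ = i z x := by rw [h.zero_imp_zero_imp_neg (i x z), h.imp_one (i x z), h.neg_neg x]

theorem neg_zero_imp_imp (h : IsInvolutiveZroupoid i z) (x y : A) :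
    i (i (i z x) y) z = i y (i (i x y) z) := by
  calc i (i (i z x) y) z
    _ = i (i (i y (i (i x y) z)) z) z := by rw [h.neg_imp_neg_self y x]
    _ = i y (i (i x y) z) := by rw [h.neg_neg (i y (i (i x y) z))]

theorem imp_neg_self (h : IsInvolutiveZroupoid i z) (x : A) :
    i x (i x z) = i x z := by
  calc i x (i x z)
    _ = i (i (i z (i z z)) x) z := by rw [h.neg_zero_imp_imp (i z z) x, h.one_imp x]
    _ = i x z := by rw [h.zero_imp_zero_imp z, h.one_imp x]

theorem imp_neg_zero_imp_self (h : IsInvolutiveZroupoid i z) (x : A) :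
    i x (i (i z x) z) = i x z := by
  calc i x (i (i z x) z)
    _ = i (i (i z z) x) z := by rw [h.neg_zero_imp_imp z x]
    _ = i x z := by rw [h.one_imp x]

theorem zero_imp_imp (h : IsInvolutiveZroupoid i z) (x y : A) :
    i (i z x) y = i (i y x) y := by
  calc i (i z x) y
    _ = i (i (i (i y z) (i (i y z) z)) (i (i x y) z)) z := by
      rw [h.imp_neg_self (i y z), h.neg_neg y, h.neg_imp_neg_self y x]
    _ = i (i y x) y := by rw [h.neg_imp_neg y (i (i y z) z) x, h.neg_neg y]

theorem neg_zero_imp_imp_self (h : IsInvolutiveZroupoid i z) (x : A) :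
    i (i (i z x) z) x = i z x := by
  calc i (i (i z x) z) x
    _ = i (i (i z x) (i (i z x) z)) z := by
      rw [h.neg_zero_imp_imp x (i (i z x) z), h.imp_neg_zero_imp_self x, h.neg_neg x]
    _ = i z x := by rw [h.imp_neg_self (i z x), h.neg_neg (i z x)]

theorem imp_zero_imp_imp_self (h : IsInvolutiveZroupoid i z) (x y : A) :
    i (i x (i z y)) x = i (i z y) x := by
  calc i (i x (i z y)) x
    _ = i (i z (i z y)) x := by rw [h.zero_imp_imp (i z y) x]
    _ = i (i z y) x := by rw [h.zero_imp_zero_imp y]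

theorem neg_zero_imp_imp_neg_imp (h : IsInvolutiveZroupoid i z) (x y : A) :
    i (i (i z x) (i (i y x) z)) z = i y x := by
  calc i (i (i z x) (i (i y x) z)) z
    _ = i (i (i (i x z) (i z z)) (i (i y x) z)) z := by rw [h.neg_imp_one x]
    _ = i y x := by rw [h.neg_imp_neg x (i z z) y, h.one_imp y]

theorem zero_imp_imp_zero_imp (h : IsInvolutiveZroupoid i z) (x y : A) :
    i (i z x) (i z y) = i x (i z y) := by
  calc i (i z x) (i z y)
    _ = i (i (i (i z x) (i z y)) z) z := by rw [h.neg_neg (i (i z x) (i z y))]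
    _ = i (i (i z (i z y)) (i (i x (i z y)) z)) z := by
      rw [h.neg_zero_imp_imp x (i z y), h.zero_imp_zero_imp y]
    _ = i x (i z y) := by rw [h.neg_zero_imp_imp_neg_imp (i z y) x]

theorem imp_imp_imp_middle (h : IsInvolutiveZroupoid i z) (x y w : A) :
    i (i x (i y w)) y = i (i x (i z w)) y := by
  calc i (i x (i y w)) y
    _ = i (i (i (i y z) x) (i (i (i z w) y) z)) z := by
      rw [h.zero_imp_imp w y, h.neg_imp_neg y x (i y w)]
    _ = i (i x (i z w)) y := by rw [h.neg_imp_neg y x (i z w)]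

theorem zero_imp_imp_zero_imp_right (h : IsInvolutiveZroupoid i z) (x y : A) :
    i z (i x (i z y)) = i z (i x y) := by
  calc i z (i x (i z y))
    _ = i z (i (i (i x (i (i z z) y)) (i z z)) z) := by
      rw [h.imp_imp_imp_middle x (i z z) y, h.imp_one (i x (i z y)),
        h.zero_imp_neg_zero_imp (i (i x (i z y)) z), h.imp_one (i (i x (i z y)) z),
        h.neg_neg (i x (i z y))]
    _ = i z (i x y) := by rw [h.zero_imp_neg_imp_one (i x (i (i z z) y)), h.one_imp y]

theorem zero_imp_zero_imp_imp (h : IsInvolutiveZroupoid i z) (x y : A) :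
    i z (i (i z x) y) = i z (i x y) := by
  calc i z (i (i z x) y)
    _ = i z (i (i (i z y) (i z x)) (i z y)) := by
      rw [h.zero_imp_imp_zero_imp_right (i (i z y) (i z x)) y, h.zero_imp_imp_zero_imp y x,
        h.imp_zero_imp_imp_self y x]
    _ = i z (i x y) := by
      rw [h.imp_zero_imp_imp_self (i z y) x, h.zero_imp_imp_zero_imp x y,
        h.zero_imp_imp_zero_imp_right x y]

theorem zero_imp_imp_imp_self (h : IsInvolutiveZroupoid i z) (x y : A) :
    i z (i (i x y) x) = i z (i y x) := by
  calc i z (i (i x y) x)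
    _ = i z (i (i z y) x) := by rw [h.zero_imp_imp y x]
    _ = i z (i y x) := by rw [h.zero_imp_zero_imp_imp y x]

theorem imp_imp_zero_imp (h : IsInvolutiveZroupoid i z) (x y : A) :
    i (i x y) (i z x) = i y (i z x) := by
  calc i (i x y) (i z x)
    _ = i (i z (i (i z x) y)) (i z x) := by
      rw [h.zero_imp_zero_imp_imp x y, h.zero_imp_imp_zero_imp (i x y) x]
    _ = i y (i z x) := by
      rw [h.imp_imp_imp_middle z (i z x) y, h.zero_imp_zero_imp y, h.zero_imp_imp_zero_imp y x]

theorem zero_imp_imp_imp_self_left (h : IsInvolutiveZroupoid i z) (x y : A) :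
    i (i (i z x) y) x = i y x := by
  calc i (i (i z x) y) x
    _ = i (i (i (i x z) (i z x)) (i (i y x) z)) z := by rw [h.neg_imp_neg x (i z x) y]
    _ = i y x := by
      rw [h.imp_imp_zero_imp x z, h.zero_imp_zero_imp x, h.neg_zero_imp_imp_neg_imp x y]

theorem imp_neg_zero_imp_imp (h : IsInvolutiveZroupoid i z) (x y : A) :
    i (i x (i (i z y) z)) y = i (i x z) y := by
  calc i (i x (i (i z y) z)) y
    _ = i (i (i (i y z) x) (i (i (i (i z y) z) y) z)) z := by rw [h.neg_imp_neg y x (i (i z y) z)]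
    _ = i (i x z) y := by rw [h.neg_zero_imp_imp_self y, h.neg_imp_neg y x z]

theorem zero_imp_imp_neg_imp (h : IsInvolutiveZroupoid i z) (x y : A) :
    i (i z x) (i (i y x) z) = i (i y x) z := by
  calc i (i z x) (i (i y x) z)
    _ = i (i (i (i z x) (i (i y x) z)) z) z := by rw [h.neg_neg (i (i z x) (i (i y x) z))]
    _ = i (i y x) z := by rw [h.neg_zero_imp_imp_neg_imp x y]

theorem zero_imp_neg_imp_imp (h : IsInvolutiveZroupoid i z) (x y : A) :
    i (i z (i x z)) (i y x) = i y x := by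
  calc i (i z (i x z)) (i y x)
    _ = i (i (i z x) (i (i y x) z)) (i y x) := by
      rw [h.imp_imp_imp_middle (i z x) (i y x) z, h.imp_one (i z x), h.zero_imp_zero_imp_imp x z]
    _ = i (i z z) (i y x) := by rw [h.zero_imp_imp_neg_imp x y, h.zero_imp_imp z (i y x)]
    _ = i y x := by rw [h.one_imp (i y x)]

theorem zero_imp_neg_imp (h : IsInvolutiveZroupoid i z) (x y : A) :
    i (i z (i x z)) y = i (i x (i y z)) y := by
  rw [h.imp_imp_imp_middle x y z, h.imp_one x]

theorem zero_imp_neg_imp_imp_self (h : IsInvolutiveZroupoid i z) (x y : A) :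
    i (i z (i (i x y) z)) y = i (i z x) y := by
  calc i (i z (i (i x y) z)) y
    _ = i (i z (i (i x (i (i y z) z)) z)) y := by rw [h.neg_neg y]
    _ = i (i z (i (i z (i x z)) z)) y := by
      rw [h.zero_imp_neg_imp (i x (i (i y z) z)) y, h.zero_imp_neg_imp (i z (i x z)) y,
        h.zero_imp_neg_imp x (i y z)]
    _ = i (i z x) y := by rw [h.zero_imp_zero_imp_imp (i x z) z, h.neg_neg x]

theorem neg_zero_imp_imp_imp_imp (h : IsInvolutiveZroupoid i z) (x y : A) :
    i (i (i (i z x) y) z) (i x y) = i x y := by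
  calc i (i (i (i z x) y) z) (i x y)
    _ = i (i z (i y z)) (i x y) := by rw [h.neg_zero_imp_imp x y, h.zero_imp_neg_imp y (i x y)]
    _ = i x y := by rw [h.zero_imp_neg_imp_imp y x]

theorem neg_zero_imp_neg_imp_imp (h : IsInvolutiveZroupoid i z) (x y : A) :
    i (i (i (i z (i x z)) y) z) x = i (i y z) x := by
  calc i (i (i (i z (i x z)) y) z) x
    _ = i (i (i (i z (i (i z x) z)) y) (i (i z x) z)) x := by
      rw [h.imp_neg_zero_imp_imp (i (i z (i (i z x) z)) y) x, h.zero_imp_imp_imp_self z x]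
    _ = i (i y z) x := by
      rw [h.zero_imp_imp_imp_self_left (i (i z x) z) y, h.imp_neg_zero_imp_imp y x]

theorem neg_imp_imp_self (h : IsInvolutiveZroupoid i z) (x y : A) :
    i (i x z) (i y x) = i y x := by
  calc i (i x z) (i y x)
    _ = i (i (i (i z (i (i y x) z)) x) z) (i y x) := by rw [h.neg_zero_imp_neg_imp_imp (i y x) x]
    _ = i y x := by rw [h.zero_imp_neg_imp_imp_self y x, h.neg_zero_imp_imp_imp_imp y x]

theorem imp_imp_neg_self (h : IsInvolutiveZroupoid i z) (x y : A) :
    i x (i y (i x z)) = i y (i x z) := by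
  calc i x (i y (i x z))
    _ = i (i (i x z) z) (i y (i x z)) := by rw [h.neg_neg x]
    _ = i y (i x z) := by rw [h.neg_imp_imp_self (i x z) y]

end IsInvolutiveZroupoid

theorem stmt_6 (A : Type*) (i : A → A → A) (z : A)
    (hI : ∀ x y w : A, i (i x y) w = i (i (i (i w z) x) (i (i y w) z)) z)
    (hI0 : i (i z z) z = z)
    (h2 : ∀ x : A, i (i x z) z = x) :
    ∀ x y : A, i x (i y (i x z)) = i y (i x z) := by
  have h : IsInvolutiveZroupoid i z := ⟨hI, h2⟩
  exact fun x y => h.imp_imp_neg_self x y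
end

section
/- In any algebra A in I₂,₀, the relation defined by x ⊑ y iff (x → y')' = x is transitive: if (a → b')' = a and (b → c')' = b, then (a → c')' = a. -/
/-- The algebras of the variety `I₂,₀`: implication zroupoids in which double negation is the
identity, negation being `x ↦ x → 0`. -/
class InvolutiveZroupoid (A : Type*) extends Zero A where
  imp : A → A → A
  imp_imp_eq (x y w : A) :
    imp (imp x y) w = imp (imp (imp (imp w 0) x) (imp (imp y w) 0)) 0
  imp_zero_imp_zero (x : A) : imp (imp x 0) 0 = x

namespace InvolutiveZroupoid

variable {A : Type*} [InvolutiveZroupoid A]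

local infixr:60 "⇒" => imp

/-- Negation, `x → 0`. -/
def neg (x : A) : A := x ⇒ 0

local prefix:max "∼" => neg

theorem imp_zero (x : A) : x ⇒ 0 = ∼x := rfl

theorem neg_neg (x : A) : ∼∼x = x := imp_zero_imp_zero x

theorem neg_injective : Function.Injective (neg : A → A) :=
  Function.LeftInverse.injective neg_neg

theorem neg_imp_imp_neg (x y w : A) : (∼w ⇒ x) ⇒ ∼(y ⇒ w) = ∼((x ⇒ y) ⇒ w) :=
  neg_injective <| (imp_imp_eq x y w).symm.trans (neg_neg _).symm

theorem imp_imp_neg (x y w : A) : (w ⇒ x) ⇒ ∼(y ⇒ ∼w) = ∼((x ⇒ y) ⇒ ∼w) := by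
  simpa only [neg_neg] using neg_imp_imp_neg x y ∼w

theorem neg_zero_imp (x : A) : ∼0 ⇒ x = x := by
  apply neg_injective
  simpa only [imp_zero, neg_neg] using neg_imp_imp_neg x 0 0

theorem imp_neg_imp_self (x y : A) : x ⇒ ∼(y ⇒ x) = ∼((0 ⇒ y) ⇒ x) := by
  simpa only [imp_zero, neg_neg] using neg_imp_imp_neg 0 y x

theorem zero_imp_imp_neg_zero (x : A) : (0 ⇒ x) ⇒ ∼0 = x ⇒ ∼0 := by
  have h := imp_neg_imp_self ∼0 x
  rw [neg_zero_imp] at h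
  exact (neg_injective h).symm

theorem zero_imp_neg_zero : (0 : A) ⇒ ∼0 = ∼0 := by
  rw [← zero_imp_imp_neg_zero, imp_zero, neg_zero_imp]

theorem neg_imp_neg_zero (x : A) : ∼x ⇒ ∼0 = 0 ⇒ x := by
  have h := imp_imp_neg x 0 0
  rw [zero_imp_neg_zero, neg_neg, imp_zero, imp_zero] at h
  exact (neg_injective h).symm

theorem imp_neg_zero (x : A) : x ⇒ ∼0 = 0 ⇒ ∼x := by
  rw [← neg_imp_neg_zero, neg_neg]

theorem imp_neg_zero_imp (x : A) : x ⇒ ∼(0 ⇒ x) = ∼x := by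
  rw [imp_neg_imp_self, imp_zero, neg_zero_imp]

theorem imp_neg_self (x : A) : x ⇒ ∼x = ∼x := by
  simpa only [neg_zero_imp, zero_imp_neg_zero] using imp_neg_imp_self x ∼0

theorem neg_imp_self (x : A) : ∼x ⇒ x = x := by
  simpa only [neg_neg] using imp_neg_self ∼x

theorem zero_imp_imp_neg (x : A) : (0 ⇒ x) ⇒ ∼x = ∼x := by
  apply neg_injective
  rw [← imp_neg_imp_self, imp_neg_self, neg_neg, neg_imp_self]

theorem zero_imp_neg_zero_imp (x : A) : 0 ⇒ ∼(0 ⇒ x) = 0 ⇒ ∼x := by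
  rw [← imp_neg_zero, zero_imp_imp_neg_zero, imp_neg_zero]

theorem zero_imp_zero_imp_neg (x : A) : 0 ⇒ (0 ⇒ ∼x) = 0 ⇒ ∼x := by
  rw [← neg_imp_neg_zero (0 ⇒ ∼x), imp_neg_zero, ← zero_imp_neg_zero_imp,
    zero_imp_neg_zero_imp ∼x, neg_neg, zero_imp_neg_zero_imp]

theorem imp_imp_neg_zero_imp_neg (x y : A) : (x ⇒ y) ⇒ ∼(0 ⇒ ∼x) = ∼(∼y ⇒ ∼x) := by
  rw [imp_imp_neg, imp_zero]

theorem zero_imp_imp_neg_zero_imp_neg (x y : A) :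
    (0 ⇒ x) ⇒ ∼(0 ⇒ ∼y) = ∼(0 ⇒ ∼(x ⇒ y)) := by
  rw [← imp_neg_zero, imp_imp_neg, imp_neg_zero]

theorem neg_imp_imp_self (x y : A) : ∼((x ⇒ y) ⇒ x) = x ⇒ ∼(y ⇒ x) := by
  rw [← neg_imp_imp_neg, neg_imp_self]

theorem neg_imp_imp_neg_right (x y : A) : ∼((x ⇒ y) ⇒ ∼y) = (y ⇒ x) ⇒ y := by
  rw [← imp_imp_neg, imp_neg_self, neg_neg]

theorem neg_imp_neg_imp_neg_zero_imp (x y : A) : ∼x ⇒ ∼(y ⇒ ∼(0 ⇒ x)) = ∼y ⇒ x := by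
  have h := imp_imp_neg ∼x y (0 ⇒ x)
  rwa [zero_imp_imp_neg, neg_imp_imp_neg, neg_neg, imp_zero] at h

theorem zero_imp_neg_imp (x y : A) : (0 ⇒ ∼y) ⇒ x = ∼((0 ⇒ y) ⇒ ∼x) := by
  apply neg_injective
  rw [← imp_neg_zero, ← neg_imp_imp_neg, neg_zero_imp, ← imp_neg_imp_self, ← neg_imp_imp_self,
    neg_neg]

theorem zero_imp_neg_zero_imp_neg_imp (x y : A) :
    0 ⇒ ∼((0 ⇒ ∼x) ⇒ y) = 0 ⇒ ∼(∼x ⇒ y) := by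
  apply neg_injective
  rw [← zero_imp_imp_neg_zero_imp_neg, ← zero_imp_imp_neg_zero_imp_neg, zero_imp_zero_imp_neg]

/-- The relation `x ⊑ y`, that is `¬(x → ¬y) = x`. -/
def Below (x y : A) : Prop := ∼(x ⇒ ∼y) = x

namespace Below

variable {a b c : A}

theorem imp_neg (h : Below a b) : a ⇒ ∼b = ∼a := by
  rw [← neg_neg (a ⇒ ∼b), show ∼(a ⇒ ∼b) = a from h]

theorem neg_imp_imp_neg (h : Below a b) (x : A) : ∼((x ⇒ a) ⇒ ∼b) = (b ⇒ x) ⇒ a := by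
  rw [← imp_imp_neg, h.imp_neg, neg_neg]

theorem zero_imp_neg_imp (h : Below a b) : (0 ⇒ ∼b) ⇒ a = a := by
  rw [← imp_neg_zero, ← h.neg_imp_imp_neg, neg_zero_imp, h.imp_neg, neg_neg]

theorem imp_neg_symm (h : Below a b) : b ⇒ ∼a = ∼a := by
  apply neg_injective
  have hx := imp_imp_neg_zero_imp_neg a ∼b
  rwa [h.imp_neg, imp_neg_zero_imp, neg_neg b, neg_neg, eq_comm, ← neg_neg a, neg_neg ∼a] at hx

theorem neg_imp_neg_zero_imp_neg (h : Below b c) : ∼b ⇒ ∼(0 ⇒ ∼c) = b := by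
  rw [← h.imp_neg_symm, imp_imp_neg_zero_imp_neg, neg_neg, h.imp_neg, neg_neg]

theorem neg_imp_comm (h : Below a b) : ∼b ⇒ a = ∼a ⇒ b := by
  have hx := neg_imp_imp_neg_right a ∼b
  rw [neg_neg, h.imp_neg] at hx
  rw [← neg_neg (∼a ⇒ b), hx, h.neg_imp_imp_neg, imp_neg_self]

theorem zero_imp_neg_imp_right (h : Below b c) : (0 ⇒ ∼b) ⇒ c = ∼b ⇒ c := by
  apply neg_injective
  rw [← imp_neg_imp_self, ← neg_imp_imp_self, h.imp_neg_symm]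

theorem neg_imp_neg_zero_imp_neg_right (h : Below b c) : ∼c ⇒ ∼(0 ⇒ ∼b) = ∼b ⇒ c := by
  apply neg_injective
  have hx := imp_imp_neg_zero_imp_neg (0 ⇒ ∼b) c
  rw [h.zero_imp_neg_imp_right, zero_imp_neg_zero_imp, neg_neg,
    InvolutiveZroupoid.neg_imp_imp_neg, imp_zero] at hx
  rw [← hx, h.neg_imp_comm]

theorem zero_imp_neg_neg_imp (h : Below a b) : 0 ⇒ ∼(∼a ⇒ b) = 0 ⇒ ∼a := by
  rw [← h.neg_imp_comm, ← zero_imp_neg_zero_imp_neg_imp, h.zero_imp_neg_imp]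

theorem imp_zero_imp_neg (h : Below a b) : a ⇒ (0 ⇒ ∼b) = 0 ⇒ ∼a := by
  have hx := imp_imp_neg a ∼0 (0 ⇒ ∼b)
  rwa [h.zero_imp_neg_imp, neg_zero_imp, neg_neg, imp_neg_zero, zero_imp_imp_neg_zero_imp_neg,
    h.zero_imp_neg_neg_imp, neg_neg] at hx

theorem neg_zero_imp_neg_imp_neg (h : Below a b) : ∼(0 ⇒ ∼b) ⇒ ∼a = 0 ⇒ ∼a := by
  apply neg_injective
  rw [← imp_imp_neg_zero_imp_neg, h.imp_zero_imp_neg, imp_neg_self]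

theorem neg_imp_imp_neg_eq (h : Below a b) (x : A) : (∼b ⇒ x) ⇒ ∼a = (0 ⇒ x) ⇒ ∼a := by
  apply neg_injective
  rw [← imp_imp_neg, h.imp_neg, imp_neg_imp_self]

theorem zero_imp_imp_neg (hab : Below a b) (hbc : Below b c) : (0 ⇒ c) ⇒ ∼a = ∼a := by
  rw [← neg_neg c, ← zero_imp_neg_zero_imp, ← hab.neg_imp_imp_neg_eq,
    hbc.neg_imp_neg_zero_imp_neg, hab.imp_neg_symm]

theorem neg_imp_neg_zero_imp_neg_trans (hab : Below a b) (hbc : Below b c) :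
    ∼a ⇒ ∼(0 ⇒ ∼c) = a := by
  apply neg_injective
  have h := imp_imp_neg a ∼b (0 ⇒ ∼c)
  rwa [hbc.neg_imp_neg_zero_imp_neg, InvolutiveZroupoid.zero_imp_neg_imp,
    hab.zero_imp_imp_neg hbc, neg_neg, hab.imp_neg, eq_comm] at h

theorem imp_neg_comm (hab : Below a b) (hbc : Below b c) : c ⇒ ∼a = a ⇒ ∼c := by
  have h := neg_imp_neg_imp_neg_zero_imp ∼c ∼a
  rwa [hab.neg_imp_neg_zero_imp_neg_trans hbc, neg_neg, neg_neg] at h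

theorem trans (hab : Below a b) (hbc : Below b c) : Below a c := by
  have h := imp_imp_neg ∼c ∼(0 ⇒ ∼b) a
  rw [hab.neg_zero_imp_neg_imp_neg, imp_imp_neg_zero_imp_neg, neg_neg,
    hbc.neg_imp_neg_zero_imp_neg_right, hab.neg_imp_imp_neg_eq, hab.zero_imp_imp_neg hbc,
    neg_neg] at h
  rwa [Below, ← hab.imp_neg_comm hbc]

end Below

end InvolutiveZroupoid

theorem stmt_13 (A : Type*) (i : A → A → A) (z : A)
    (hI : ∀ x y w : A, i (i x y) w = i (i (i (i w z) x) (i (i y w) z)) z)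
    (hI0 : i (i z z) z = z)
    (h2 : ∀ x : A, i (i x z) z = x)
    (a b c : A) (hab : i (i a (i b z)) z = a) (hbc : i (i b (i c z)) z = b) :
    i (i a (i c z)) z = a :=
  letI : InvolutiveZroupoid A := { zero := z, imp := i, imp_imp_eq := hI, imp_zero_imp_zero := h2 }
  InvolutiveZroupoid.Below.trans (a := a) (b := b) (c := c) hab hbc
end
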